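/- arXiv:1407.7929 — 3 statements merged into one kernel-verified Lean document; each statement's English description precedes it below -/
import Mathlib

section
/- Let α and β be types, let R : α → α → Prop and S : β → β → Prop be step relations, and let f : α → β. Define the sequenced relation T on α ⊕ β by: T (inl a) (inl a') iff R a a'; T (inl a) (inr b) iff a is R-normal (there is no a' with R a a') and b = f a; and T (inr b) (inr b') iff S b b'. If a₀ is strongly normalizing for R (i.e. a₀ is accessible with respect to the transpose of R, Acc (fun x y => R y x) a₀) and every b : β is strongly normalizing for S, then inl a₀ is strongly normalizing for T (i.e. Acc (fun x y => T y x) (inl a₀)). -/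
/-- The sequenced relation on `α ⊕ β`: run `R`-steps on the left; when an
`R`-normal element is reached, jump via `f` to the right; then run `S`-steps. -/
def seqRel {α β : Type*} (R : α → α → Prop) (S : β → β → Prop) (f : α → β) :
    α ⊕ β → α ⊕ β → Prop
  | Sum.inl a, Sum.inl a' => R a a'
  | Sum.inl a, Sum.inr b => (∀ a', ¬ R a a') ∧ b = f a
  | Sum.inr _, Sum.inl _ => False
  | Sum.inr b, Sum.inr b' => S b b'

theorem acc_seqRel_inr {α β : Type*} (R : α → α → Prop) {S : β → β → Prop} (f : α → β) {b : β}
    (hb : Acc (fun x y => S y x) b) : Acc (fun x y => seqRel R S f y x) (Sum.inr b) := by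
  induction hb with
  | intro b _ ih =>
    refine ⟨_, ?_⟩
    rintro (a | b') h
    · exact h.elim
    · exact ih b' h

theorem seq_strongly_normalizing {α β : Type*}
    (R : α → α → Prop) (S : β → β → Prop) (f : α → β) (a₀ : α)
    (hA : Acc (fun x y => R y x) a₀)
    (hB : ∀ b : β, Acc (fun x y => S y x) b) :
    Acc (fun x y => seqRel R S f y x) (Sum.inl a₀) := by
  induction hA with
  | intro a _ ih =>
    refine ⟨_, ?_⟩
    rintro (a' | b) h
    · exact ih a' h
    · exact acc_seqRel_inr R f (hB b)
end

section
/- Let r : α → Multiset α → Prop be a step relation taking an element to a multiset of successors, and let res : α → Prop be a predicate ("results") such that results have no r-successor (res a → ∀ m, ¬ r a m). Define the parallel lift relation Lift on Multiset α by: Lift M M' iff there is a multiset N of non-result elements of M with N nonempty, M = N + V where every element of V satisfies res, and M' = (N.bind σ) + V for some function σ assigning to each element a of N a multiset σ a with r a (σ a). If r is deterministic in the sense that for all a, m, m', r a m and r a m' imply m = m', then Lift is deterministic: for all M, M₁, M₂, if Lift M M₁ and Lift M M₂ then M₁ = M₂. -/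
/-- The parallel lift of a step relation `r : α → Multiset α → Prop` to multisets:
all non-result elements step simultaneously, results are left unchanged. -/
def Lift {α : Type*} (r : α → Multiset α → Prop) (res : α → Prop) :
    Multiset α → Multiset α → Prop := fun M M' =>
  ∃ (N V : Multiset α) (σ : α → Multiset α),
    N ≠ 0 ∧ (∀ a ∈ N, ¬ res a) ∧ M = N + V ∧ (∀ a ∈ V, res a) ∧
    (∀ a ∈ N, r a (σ a)) ∧ M' = N.bind σ + V

theorem lift_deterministic {α : Type*} (r : α → Multiset α → Prop) (res : α → Prop)
    (hres : ∀ a, res a → ∀ m, ¬ r a m)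
    (hdet : ∀ a m m', r a m → r a m' → m = m') :
    ∀ M M₁ M₂ : Multiset α, Lift r res M M₁ → Lift r res M M₂ → M₁ = M₂ := by
  classical
  have filter_eq {N V : Multiset α} (hN : ∀ a ∈ N, ¬ res a) (hV : ∀ a ∈ V, res a) :
      (N + V).filter (fun a => ¬ res a) = N := by
    rw [Multiset.filter_add, Multiset.filter_eq_self.2 hN,
      Multiset.filter_eq_nil.2 fun a ha => not_not.2 (hV a ha), add_zero]
  rintro M _ _ ⟨N, V, σ, -, hN, rfl, hV, hσ, rfl⟩ ⟨N', V', σ', -, hN', h, hV', hσ', rfl⟩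
  obtain rfl : N = N' := by rw [← filter_eq hN hV, h, filter_eq hN' hV']
  obtain rfl : V = V' := add_left_cancel h
  rw [Multiset.bind_congr fun a ha => hdet a _ _ (hσ a ha) (hσ' a ha)]
end

section
/- Let r : α → Multiset α → Prop be a deterministic step relation (for all a, m, m', r a m and r a m' imply m = m'), and let res : α → Prop satisfy: results have no r-successor (res a → ∀ m, ¬ r a m). Define the parallel lift relation Lift on Multiset α by: Lift M M' iff there is a nonempty multiset N of non-result elements of M with M = N + V, every element of V satisfying res, and M' = (N.bind σ) + V for some function σ with r a (σ a) for each a in N. Then from any multiset M₀ there is at most one Lift-terminal multiset reachable: if Relation.ReflTransGen Lift M₀ M₁ and Relation.ReflTransGen Lift M₀ M₂ and neither M₁ nor M₂ has a Lift-successor, then M₁ = M₂. -/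
theorem Lift.rightUnique {α : Type*} {r : α → Multiset α → Prop} {res : α → Prop}
    (hdet : ∀ a m m', r a m → r a m' → m = m') : Relator.RightUnique (Lift r res) := by
  classical
  rintro M _ _ ⟨N, V, σ, -, hN, rfl, hV, hσ, rfl⟩ ⟨N', V', τ, -, hN', h, hV', hτ, rfl⟩
  have hNN : N = N' := by
    have := congrArg (Multiset.filter fun a => ¬ res a) h
    simpa [Multiset.filter_add, Multiset.filter_eq_self.2 hN, Multiset.filter_eq_self.2 hN',
      Multiset.filter_eq_nil.2 fun a ha => not_not.2 (hV a ha),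
      Multiset.filter_eq_nil.2 fun a ha => not_not.2 (hV' a ha)] using this
  subst hNN
  rw [add_left_cancel h, Multiset.bind_congr fun a ha => hdet a _ _ (hσ a ha) (hτ a ha)]

theorem lift_unique_terminal {α : Type*} (r : α → Multiset α → Prop) (res : α → Prop)
    (hdet : ∀ a m m', r a m → r a m' → m = m')
    (hres : ∀ a, res a → ∀ m, ¬ r a m)
    (M₀ M₁ M₂ : Multiset α)
    (h1 : Relation.ReflTransGen (Lift r res) M₀ M₁)
    (h2 : Relation.ReflTransGen (Lift r res) M₀ M₂)
    (t1 : ∀ M', ¬ Lift r res M₁ M') (t2 : ∀ M', ¬ Lift r res M₂ M') :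
    M₁ = M₂ := by
  rcases Relation.ReflTransGen.total_of_right_unique (Lift.rightUnique hdet) h1 h2 with h | h
  · rcases h.cases_head with rfl | ⟨M, hM, -⟩
    · rfl
    · exact (t1 M hM).elim
  · rcases h.cases_head with rfl | ⟨M, hM, -⟩
    · rfl
    · exact (t2 M hM).elim
end
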